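/- Main theorem: Every graph G of width at most r with capacities c and lengths l admits a small diameter decomposition (all components of G minus the cut edges have d_G-diameter strictly less than 1) of total capacity at most 136·ln(r+1)·Σ_{e∈E} c(e)·l(e). -/

import Mathlib

open scoped ENNReal

/-- Length of a walk with respect to edge lengths `l`. -/
noncomputable def walkLen {V : Type*} {G : SimpleGraph V} (l : Sym2 V → NNReal)
    {u v : V} (p : G.Walk u v) : ℝ≥0∞ :=
  (p.edges.map fun e => (l e : ℝ≥0∞)).sum

/-- Shortest-path distance in `G` with edge lengths `l` (`∞` if disconnected). -/
noncomputable def wdist {V : Type*} (G : SimpleGraph V) (l : Sym2 V → NNReal)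
    (u v : V) : ℝ≥0∞ :=
  ⨅ p : G.Walk u v, walkLen l p

/-- Moving the threshold `x = -s` of the truncation `max p (min x q)` downwards changes it at
unit speed while `x` lies in `(p, q]` and leaves it unchanged otherwise. -/
theorem hasDerivWithinAt_clamp_neg {p q : ℝ} (hpq : p ≤ q) (s : ℝ) :
    HasDerivWithinAt (fun s => max p (min (-s) q)) (if p < -s ∧ -s ≤ q then -1 else 0)
      (Set.Ici s) s := by
  split_ifs with h
  · refine ((hasDerivAt_id s).neg.hasDerivWithinAt).congr_of_eventuallyEq ?_ ?_
    · have h1 : ∀ᶠ y in nhdsWithin s (Set.Ici s), y < -p :=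
        nhdsWithin_le_nhds (eventually_lt_nhds (by linarith [h.1]))
      filter_upwards [h1, self_mem_nhdsWithin] with y hy hy'
      have : s ≤ y := hy'
      simp only [Pi.neg_apply, id]
      rw [min_eq_left (by linarith [h.2]), max_eq_right (by linarith)]
    · simp only [Pi.neg_apply, id]
      rw [min_eq_left h.2, max_eq_right h.1.le]
  · rw [not_and_or, not_lt, not_le] at h
    rcases h with h | h
    · refine (hasDerivWithinAt_const s (Set.Ici s) p).congr ?_ ?_
      · intro y hy
        have : s ≤ y := hy
        exact max_eq_left ((min_le_left _ _).trans (by linarith))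
      · exact max_eq_left ((min_le_left _ _).trans (by linarith))
    · refine (hasDerivWithinAt_const s (Set.Ici s) q).congr_of_eventuallyEq ?_ ?_
      · have h1 : ∀ᶠ y in nhdsWithin s (Set.Ici s), y < -q :=
          nhdsWithin_le_nhds (eventually_lt_nhds (by linarith))
        filter_upwards [h1] with y hy
        rw [min_eq_right (by linarith), max_eq_right hpq]
      · rw [min_eq_right h.le, max_eq_right hpq]

/-- Region growing: some threshold in `(a, b]` cuts little capacity compared with the mass on
the near side of the cut. -/
theorem exists_cut_le {ε : Type*} (E : Finset ε) (c m p q : ε → ℝ) (hc : ∀ e ∈ E, 0 ≤ c e)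
    (hm : ∀ e ∈ E, 0 ≤ m e) (hpq : ∀ e ∈ E, p e ≤ q e)
    (hcm : ∀ e ∈ E, c e * (q e - p e) ≤ m e) {a b η κ : ℝ} (hab : a < b)
    (hκ : 0 ≤ κ) (hexp : 1 + η < η * Real.exp (κ * (b - a))) :
    ∃ x ∈ Set.Ioc a b, ∑ e ∈ E with p e < x ∧ x ≤ q e, c e ≤
      κ * (∑ e ∈ E with p e < x ∧ a < q e, m e + η * ∑ e ∈ E with p e < b ∧ a < q e, m e) := by
  by_contra! hcut
  set M := ∑ e ∈ E with p e < b ∧ a < q e, m e with hM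
  have hM0 : 0 ≤ M := Finset.sum_nonneg fun e he => hm e (Finset.mem_filter.1 he).1
  let φ : ε → ℝ → ℝ := fun e x => max (p e) (min x (q e))
  let g : ℝ → ℝ := fun x => ∑ e ∈ E, c e * (φ e x - φ e a)
  have hg_le : ∀ x, a ≤ x → g x ≤ ∑ e ∈ E with p e < x ∧ a < q e, m e := by
    intro x hx
    rw [Finset.sum_filter]
    refine Finset.sum_le_sum fun e he => ?_
    have hpqe := hpq e he
    split_ifs with h
    · refine le_trans (mul_le_mul_of_nonneg_left ?_ (hc e he)) (hcm e he)
      have h1 : φ e x ≤ q e := max_le hpqe (min_le_right _ _)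
      have h2 : p e ≤ φ e a := le_max_left _ _
      linarith
    · have : φ e x = φ e a := by
        rw [not_and_or, not_lt, not_lt] at h
        simp only [φ]
        rcases h with h | h
        · rw [max_eq_left ((min_le_left _ _).trans h),
            max_eq_left ((min_le_left _ _).trans (hx.trans h))]
        · rw [min_eq_right (h.trans hx), min_eq_right h]
      rw [this]; simp
  let f : ℝ → ℝ := fun s => (g (-s) + η * M) * Real.exp (κ * (s + b))
  let f' : ℝ → ℝ := fun s =>
    (∑ e ∈ E, c e * (if p e < -s ∧ -s ≤ q e then -1 else 0)) * Real.exp (κ * (s + b)) +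
      (g (-s) + η * M) * (Real.exp (κ * (s + b)) * κ)
  have hf' : ∀ s, HasDerivWithinAt f (f' s) (Set.Ici s) s := by
    intro s
    have h1 : HasDerivWithinAt (fun s => g (-s) + η * M)
        (∑ e ∈ E, c e * (if p e < -s ∧ -s ≤ q e then -1 else 0)) (Set.Ici s) s := by
      refine HasDerivWithinAt.add_const _ ?_
      refine HasDerivWithinAt.fun_sum fun e he => ?_
      exact ((hasDerivWithinAt_clamp_neg (hpq e he) s).sub_const _).const_mul _
    have h2 : HasDerivAt (fun s => Real.exp (κ * (s + b))) (Real.exp (κ * (s + b)) * κ) s := by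
      have := (((hasDerivAt_id s).add_const b).const_mul κ).exp
      simpa using this
    exact h1.mul h2.hasDerivWithinAt
  have hfc : ContinuousOn f (Set.Icc (-b) (-a)) := by
    apply Continuous.continuousOn
    simp only [f, g, φ]
    fun_prop
  have hbound : ∀ s ∈ Set.Ico (-b) (-a), f' s ≤ 0 := by
    intro s hs
    have h1 := hcut (-s) ⟨by linarith [hs.2], by linarith [hs.1]⟩
    have h2 := hg_le (-s) (by linarith [hs.2])
    have h3 : ∑ e ∈ E, c e * (if p e < -s ∧ -s ≤ q e then (-1 : ℝ) else 0) =
        -∑ e ∈ E with p e < -s ∧ -s ≤ q e, c e := by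
      rw [Finset.sum_filter, ← Finset.sum_neg_distrib]
      exact Finset.sum_congr rfl fun e _ => by split_ifs <;> simp
    have h4 : κ * (g (-s) + η * M) ≤ κ * (∑ e ∈ E with p e < -s ∧ a < q e, m e + η * M) :=
      mul_le_mul_of_nonneg_left (by linarith) hκ
    have h5 : f' s = (-(∑ e ∈ E with p e < -s ∧ -s ≤ q e, c e) + κ * (g (-s) + η * M)) *
        Real.exp (κ * (s + b)) := by
      simp only [f']
      rw [h3]; ring
    rw [h5]
    exact mul_nonpos_of_nonpos_of_nonneg (by linarith) (Real.exp_pos _).le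
  have hfin := image_le_of_deriv_right_le_deriv_boundary (B := fun _ => f (-b)) (B' := fun _ => 0)
    hfc (fun s _ => hf' s) le_rfl continuousOn_const (fun s _ => hasDerivWithinAt_const _ _ _)
    hbound (Set.right_mem_Icc.2 (by linarith))
  have hfa : f (-a) = η * M * Real.exp (κ * (b - a)) := by
    simp only [f, g, neg_neg, sub_self, mul_zero, Finset.sum_const_zero, zero_add]
    congr 3; ring
  have hfb : f (-b) = g b + η * M := by simp [f]
  have hgb := hg_le b hab.le
  have hMzero : M = 0 := by
    by_contra hne
    have hMpos : 0 < M := lt_of_le_of_ne hM0 (Ne.symm hne)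
    have := mul_lt_mul_of_pos_right hexp hMpos
    simp only [hfa, hfb] at hfin
    nlinarith
  have hb := hcut b ⟨hab, le_rfl⟩
  rw [← hM, hMzero] at hb
  have hlt : 0 < ∑ e ∈ E with p e < b ∧ b ≤ q e, c e := by linarith
  obtain ⟨e, he, hce⟩ : ∃ e ∈ E.filter (fun e => p e < b ∧ b ≤ q e), 0 < c e := by
    by_contra! hcon
    exact absurd (Finset.sum_nonpos hcon) (not_le.2 hlt)
  rw [Finset.mem_filter] at he
  have hme : 0 < m e :=
    lt_of_lt_of_le (mul_pos hce (by linarith [he.2.1, he.2.2])) (hcm e he.1)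
  have : m e ≤ M := Finset.single_le_sum (f := m)
    (fun e he => hm e (Finset.mem_filter.1 he).1)
    (Finset.mem_filter.2 ⟨he.1, he.2.1, lt_of_lt_of_le hab he.2.2⟩)
  linarith

/-- Region growing from the far end: the mirror image of `exists_cut_le`. -/
theorem exists_cut_le_above {ε : Type*} (E : Finset ε) (c m p q : ε → ℝ)
    (hc : ∀ e ∈ E, 0 ≤ c e) (hm : ∀ e ∈ E, 0 ≤ m e) (hpq : ∀ e ∈ E, p e ≤ q e)
    (hcm : ∀ e ∈ E, c e * (q e - p e) ≤ m e) {a b η κ : ℝ} (hab : a < b)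
    (hκ : 0 ≤ κ) (hexp : 1 + η < η * Real.exp (κ * (b - a))) :
    ∃ t ∈ Set.Ico a b, ∑ e ∈ E with p e ≤ t ∧ t < q e, c e ≤
      κ * (∑ e ∈ E with t < q e ∧ p e < b, m e + η * ∑ e ∈ E with a < q e ∧ p e < b, m e) := by
  obtain ⟨x, hx, h⟩ := exists_cut_le E c m (fun e => -q e) (fun e => -p e) hc hm
    (fun e he => neg_le_neg (hpq e he)) (fun e he => by linarith [hcm e he])
    (neg_lt_neg hab) hκ (by rwa [neg_sub_neg])
  refine ⟨-x, ⟨by linarith [hx.2], by linarith [hx.1]⟩, ?_⟩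
  have h1 : (E.filter fun e => p e ≤ -x ∧ -x < q e) =
      E.filter fun e => -q e < x ∧ x ≤ -p e :=
    Finset.filter_congr fun e _ => by rw [neg_lt (a := q e), le_neg (a := x), and_comm]
  have h2 : (E.filter fun e => -x < q e ∧ p e < b) =
      E.filter fun e => -q e < x ∧ -b < -p e :=
    Finset.filter_congr fun e _ => by rw [neg_lt (a := q e), neg_lt_neg_iff]
  have h3 : (E.filter fun e => a < q e ∧ p e < b) =
      E.filter fun e => -q e < -a ∧ -b < -p e :=
    Finset.filter_congr fun e _ => by rw [neg_lt_neg_iff, neg_lt_neg_iff]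
  rw [h1, h2, h3]
  exact h

section RegionGrowing

variable {V : Type*} (E : Finset (Sym2 V)) (c l : Sym2 V → NNReal) (h : V → ℝ)

theorem Sym2.inf_map_lt_iff (e : Sym2 V) (x : ℝ) : (e.map h).inf < x ↔ ∃ u ∈ e, h u < x := by
  induction e with | _ u v => simp

theorem Sym2.inf_map_le_iff (e : Sym2 V) (x : ℝ) : (e.map h).inf ≤ x ↔ ∃ u ∈ e, h u ≤ x := by
  induction e with | _ u v => simp

theorem Sym2.lt_sup_map_iff (e : Sym2 V) (x : ℝ) : x < (e.map h).sup ↔ ∃ u ∈ e, x < h u := by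
  induction e with | _ u v => simp

theorem Sym2.le_sup_map_iff (e : Sym2 V) (x : ℝ) : x ≤ (e.map h).sup ↔ ∃ u ∈ e, x ≤ h u := by
  induction e with | _ u v => simp

variable {E c l h}

theorem capacity_mul_sup_sub_inf_le (hL : ∀ u v, s(u, v) ∈ E → h v ≤ h u + l s(u, v)) :
    ∀ e ∈ E, (c e : ℝ) * ((e.map h).sup - (e.map h).inf) ≤ c e * l e := by
  intro e he
  refine mul_le_mul_of_nonneg_left ?_ (c e).2
  induction e with | _ u v =>
  have h1 := hL u v he
  have h2 := hL v u (Sym2.eq_swap ▸ he)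
  rw [Sym2.eq_swap] at h2
  simp only [Sym2.map_mk, Sym2.sup_mk, Sym2.inf_mk]
  rcases le_total (h u) (h v) with h3 | h3
  · rw [sup_eq_right.2 h3, inf_eq_left.2 h3]; linarith
  · rw [sup_eq_left.2 h3, inf_eq_right.2 h3]; linarith

open Classical in
/-- Region growing for the edges of a graph and a function that is Lipschitz along them. -/
theorem exists_edge_cut_le (c : Sym2 V → NNReal)
    (hL : ∀ u v, s(u, v) ∈ E → h v ≤ h u + l s(u, v)) {a b η κ : ℝ}
    (hab : a < b) (hκ : 0 ≤ κ) (hexp : 1 + η < η * Real.exp (κ * (b - a))) :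
    ∃ x ∈ Set.Ioc a b, ∑ e ∈ E with (∃ u ∈ e, h u < x) ∧ ∃ u ∈ e, x ≤ h u, (c e : ℝ) ≤
      κ * (∑ e ∈ E with (∃ u ∈ e, h u < x) ∧ ∃ u ∈ e, a < h u, (c e * l e : ℝ) +
        η * ∑ e ∈ E with (∃ u ∈ e, h u < b) ∧ ∃ u ∈ e, a < h u, (c e * l e : ℝ)) := by
  simp_rw [← Sym2.inf_map_lt_iff, ← Sym2.lt_sup_map_iff, ← Sym2.le_sup_map_iff]
  exact exists_cut_le E _ _ _ _ (fun e _ => (c e).2) (fun e _ => (c e * l e).2)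
    (fun e _ => e.map h |>.inf_le_sup) (capacity_mul_sup_sub_inf_le hL) hab hκ hexp

open Classical in
/-- Region growing from the far end for the edges of a graph. -/
theorem exists_edge_cut_le_above (c : Sym2 V → NNReal)
    (hL : ∀ u v, s(u, v) ∈ E → h v ≤ h u + l s(u, v)) {a b η κ : ℝ}
    (hab : a < b) (hκ : 0 ≤ κ) (hexp : 1 + η < η * Real.exp (κ * (b - a))) :
    ∃ t ∈ Set.Ico a b, ∑ e ∈ E with (∃ u ∈ e, h u ≤ t) ∧ ∃ u ∈ e, t < h u, (c e : ℝ) ≤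
      κ * (∑ e ∈ E with (∃ u ∈ e, t < h u) ∧ ∃ u ∈ e, h u < b, (c e * l e : ℝ) +
        η * ∑ e ∈ E with (∃ u ∈ e, a < h u) ∧ ∃ u ∈ e, h u < b, (c e * l e : ℝ)) := by
  simp_rw [← Sym2.inf_map_lt_iff, ← Sym2.lt_sup_map_iff, ← Sym2.inf_map_le_iff]
  exact exists_cut_le_above E _ _ _ _ (fun e _ => (c e).2) (fun e _ => (c e * l e).2)
    (fun e _ => e.map h |>.inf_le_sup) (capacity_mul_sup_sub_inf_le hL) hab hκ hexp

end RegionGrowing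

section TruncatedDistance

variable {V : Type*}

/-- `Near E l S z d`: some walk along edges in `E` of length `d` leads from `S` to `z`. -/
inductive Near (E : Finset (Sym2 V)) (l : Sym2 V → NNReal) (S : Set V) : V → ℝ → Prop
  | base {s : V} : s ∈ S → Near E l S s 0
  | step {u v : V} {d : ℝ} : Near E l S u d → s(u, v) ∈ E → Near E l S v (d + l s(u, v))

/-- The distance from `S` along edges in `E`, truncated at `1`. -/
noncomputable def truncDist (E : Finset (Sym2 V)) (l : Sym2 V → NNReal) (S : Set V) (z : V) : ℝ :=
  sInf (insert 1 {d | Near E l S z d})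

variable {E E' : Finset (Sym2 V)} {l : Sym2 V → NNReal} {S S' : Set V} {z : V} {d x : ℝ}

theorem Near.mono (hE : E ⊆ E') (hS : S ⊆ S') (h : Near E l S z d) : Near E' l S' z d := by
  induction h with
  | base hs => exact .base (hS hs)
  | step _ he ih => exact .step ih (hE he)

theorem Near.nonneg (h : Near E l S z d) : 0 ≤ d := by
  induction h with
  | base _ => exact le_rfl
  | step _ _ ih => exact add_nonneg ih (NNReal.coe_nonneg _)

theorem Near.exists_mem (h : Near E l S z d) : ∃ s ∈ S, Near E l {s} z d := by
  induction h with
  | @base s hs => exact ⟨s, hs, .base rfl⟩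
  | step _ he ih =>
    obtain ⟨s, hs, h⟩ := ih
    exact ⟨s, hs, h.step he⟩

theorem bddBelow_near : BddBelow (insert 1 {d | Near E l S z d}) :=
  ⟨0, by rintro y (rfl | hy); exacts [zero_le_one, hy.nonneg]⟩

theorem truncDist_le_one : truncDist E l S z ≤ 1 :=
  csInf_le bddBelow_near (Set.mem_insert _ _)

theorem Near.truncDist_le (h : Near E l S z d) : truncDist E l S z ≤ d :=
  csInf_le bddBelow_near (Set.mem_insert_of_mem _ h)

theorem le_truncDist (hx : x ≤ 1) (h : ∀ d, Near E l S z d → x ≤ d) : x ≤ truncDist E l S z :=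
  le_csInf (Set.insert_nonempty _ _) (by rintro y (rfl | hy); exacts [hx, h y hy])

theorem truncDist_nonneg : 0 ≤ truncDist E l S z :=
  le_truncDist zero_le_one fun _ h => h.nonneg

theorem truncDist_eq_zero (hz : z ∈ S) : truncDist E l S z = 0 :=
  le_antisymm (Near.base hz).truncDist_le truncDist_nonneg

theorem exists_near_lt (hx : x ≤ 1) (h : truncDist E l S z < x) : ∃ d < x, Near E l S z d := by
  by_contra! hcon
  exact absurd (le_truncDist hx fun d hd => not_lt.1 fun hlt => hcon d hlt hd) (not_le.2 h)

theorem truncDist_le_add {u v : V} (he : s(u, v) ∈ E) :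
    truncDist E l S v ≤ truncDist E l S u + l s(u, v) := by
  rw [← sub_le_iff_le_add]
  refine le_truncDist ?_ fun d hd => ?_
  · linarith [truncDist_le_one (E := E) (l := l) (S := S) (z := v), (l s(u, v)).2]
  · linarith [(hd.step he).truncDist_le]

theorem Near.exists_walk {G : SimpleGraph V} {s : V} (hE : ∀ e ∈ E, e ∈ G.edgeSet)
    (h : Near E l {s} z d) : ∃ p : G.Walk s z, walkLen l p = ENNReal.ofReal d := by
  induction h with
  | base hs => exact hs ▸ ⟨.nil, by simp [walkLen]⟩
  | step h he ih =>
    obtain ⟨p, hp⟩ := ih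
    refine ⟨p.concat (G.mem_edgeSet.1 (hE _ he)), ?_⟩
    rw [ENNReal.ofReal_add h.nonneg (NNReal.coe_nonneg _), ← hp]
    simp [walkLen, SimpleGraph.Walk.edges_concat]

end TruncatedDistance

section RootedTree

variable {ι : Type*}

/-- `Anc par b i`: the node `b` is an ancestor of `i` (possibly `i` itself). -/
def Anc (par : ι → ι) (b i : ι) : Prop := ∃ n : ℕ, par^[n] i = b

/-- `par` is the parent function of a tree with the given root, the root being its own parent,
and `dep` is the depth function. -/
structure IsTreeWith (par : ι → ι) (root : ι) (dep : ι → ℕ) : Prop where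
  par_root : par root = root
  dep_par : ∀ i, i ≠ root → dep i = dep (par i) + 1

variable {par : ι → ι} {root : ι} {dep : ι → ℕ} {a b i : ι}

theorem Anc.refl (i : ι) : Anc par i i := ⟨0, rfl⟩

theorem Anc.of_par (h : Anc par b (par i)) : Anc par b i := by
  obtain ⟨n, hn⟩ := h
  exact ⟨n + 1, hn⟩

theorem Anc.to_par (h : Anc par b i) (hne : b ≠ i) : Anc par b (par i) := by
  obtain ⟨_ | n, hn⟩ := h
  · exact absurd hn.symm hne
  · exact ⟨n, hn⟩

theorem Anc.trans (h : Anc par a b) (h' : Anc par b i) : Anc par a i := by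
  obtain ⟨n, rfl⟩ := h
  obtain ⟨k, rfl⟩ := h'
  exact ⟨n + k, Function.iterate_add_apply _ _ _ _⟩

theorem Anc.total (h : Anc par a i) (h' : Anc par b i) : Anc par a b ∨ Anc par b a := by
  obtain ⟨n, rfl⟩ := h
  obtain ⟨k, rfl⟩ := h'
  rcases le_total n k with hnk | hnk
  · obtain ⟨j, rfl⟩ := Nat.exists_eq_add_of_le' hnk
    exact .inr ⟨j, (Function.iterate_add_apply _ _ _ _).symm⟩
  · obtain ⟨j, rfl⟩ := Nat.exists_eq_add_of_le' hnk
    exact .inl ⟨j, (Function.iterate_add_apply _ _ _ _).symm⟩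

namespace IsTreeWith

theorem anc_root_iff (hT : IsTreeWith par root dep) : Anc par b root ↔ b = root := by
  refine ⟨?_, fun h => h ▸ .refl _⟩
  rintro ⟨n, rfl⟩
  exact Function.iterate_fixed hT.par_root n

theorem dep_le (hT : IsTreeWith par root dep) (h : Anc par b i) : dep b ≤ dep i := by
  obtain ⟨n, rfl⟩ := h
  induction n generalizing i with
  | zero => exact le_rfl
  | succ n ih =>
    refine (ih (i := par i)).trans ?_
    by_cases hi : i = root
    · rw [hi, hT.par_root]
    · rw [hT.dep_par i hi]; exact Nat.le_succ _

theorem not_anc_par (hT : IsTreeWith par root dep) (hi : i ≠ root) : ¬Anc par i (par i) := by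
  intro h
  have := hT.dep_le h
  rw [hT.dep_par i hi] at this
  omega

theorem induction (hT : IsTreeWith par root dep) {P : ι → Prop} (base : P root)
    (step : ∀ i, i ≠ root → P (par i) → P i) (i : ι) : P i := by
  induction hn : dep i generalizing i with
  | zero =>
    by_cases hi : i = root
    · exact hi ▸ base
    · have := hT.dep_par i hi
      omega
  | succ n ih =>
    by_cases hi : i = root
    · exact hi ▸ base
    · exact step i hi (ih _ (by have := hT.dep_par i hi; omega))

end IsTreeWith

end RootedTree

section Layers

variable {V ι : Type*} {E : Finset (Sym2 V)} {l : Sym2 V → NNReal} {par : ι → ι} {root : ι}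
  {dep : ι → ℕ} {K : Set V} {att : V → ι} {a b i : ι} {z : V}

/-- Edges join vertices attached to the same node, or core vertices attached to adjacent nodes;
no core vertex is attached to the root. -/
structure IsLayered (E : Finset (Sym2 V)) (par : ι → ι) (root : ι) (K : Set V) (att : V → ι) :
    Prop where
  edge : ∀ u v, s(u, v) ∈ E → att u = att v ∨
    (u ∈ K ∧ v ∈ K ∧ (att u = par (att v) ∨ att v = par (att u)))
  ne_root : ∀ k ∈ K, att k ≠ root

/-- Truncated distance from the core vertices attached to the node `b`. -/
noncomputable def coreDist (E : Finset (Sym2 V)) (l : Sym2 V → NNReal) (K : Set V) (att : V → ι)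
    (b : ι) (z : V) : ℝ :=
  truncDist E l {k | k ∈ K ∧ att k = b} z

namespace IsLayered

theorem entering (hE : IsLayered E par root K att) {u v : V} (he : s(u, v) ∈ E)
    (hu : ¬Anc par b (att u)) (hv : Anc par b (att v)) :
    att v = b ∧ att u = par b ∧ u ∈ K ∧ v ∈ K := by
  rcases hE.edge u v he with h | ⟨huK, hvK, h | h⟩
  · exact absurd (h ▸ hv) hu
  · have : b = att v := by
      by_contra hne
      exact hu (h ▸ hv.to_par hne)
    exact ⟨this.symm, this ▸ h, huK, hvK⟩
  · exact absurd (Anc.of_par (h ▸ hv)) hu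

theorem near_split (hE : IsLayered E par root K att) {S : Set V} {d : ℝ}
    (hS : ∀ s ∈ S, ¬Anc par b (att s)) (hz : Anc par b (att z)) (h : Near E l S z d) :
    ∃ y ∈ K, att y = b ∧ ∃ d₁ d₂, d₁ + d₂ = d ∧ Near E l S y d₁ ∧
      Near E l {k | k ∈ K ∧ att k = b} z d₂ := by
  induction h with
  | base hs => exact absurd hz (hS _ hs)
  | @step u v d h he ih =>
    by_cases hu : Anc par b (att u)
    · obtain ⟨y, hy, hyb, d₁, d₂, rfl, h₁, h₂⟩ := ih hu
      exact ⟨y, hy, hyb, d₁, _, (add_assoc _ _ _).symm, h₁, h₂.step he⟩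
    · obtain ⟨hv, -, -, hvK⟩ := hE.entering he hu hz
      exact ⟨v, hvK, hv, _, 0, add_zero _, h.step he, .base ⟨hvK, hv⟩⟩

theorem le_coreDist (hT : IsTreeWith par root dep) (hE : IsLayered E par root K att)
    (hai : Anc par a i) (hne : a ≠ i) (hz : Anc par i (att z)) {x y : ℝ}
    (hx : ∀ k ∈ K, att k = i → x ≤ coreDist E l K att a k) (hy : y ≤ 1)
    (hyx : y ≤ x + coreDist E l K att i z) : y ≤ coreDist E l K att a z := by
  refine le_truncDist hy fun d hd => ?_
  have hS : ∀ s ∈ {k | k ∈ K ∧ att k = a}, ¬Anc par i (att s) := by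
    intro s hs hanc
    have hs' : Anc par i a := hs.2 ▸ hanc
    by_cases hi : i = root
    · exact hne (hi ▸ (hT.anc_root_iff.1 (hi ▸ hai)))
    · exact hT.not_anc_par hi (hs'.trans (hai.to_par hne))
  obtain ⟨k, hk, hki, d₁, d₂, rfl, h₁, h₂⟩ := hE.near_split hS hz hd
  exact hyx.trans (add_le_add ((hx k hk hki).trans h₁.truncDist_le) h₂.truncDist_le)

theorem coreDist_le_par (hT : IsTreeWith par root dep) (hE : IsLayered E par root K att)
    (hz : Anc par b (att z)) : coreDist E l K att b z ≤ coreDist E l K att (par b) z := by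
  by_cases hb : b = root
  · rw [hb, hT.par_root]
  · refine hE.le_coreDist hT (Anc.of_par (.refl _)) (fun h => ?_) hz (x := 0)
      (fun _ _ _ => truncDist_nonneg) truncDist_le_one (by rw [zero_add])
    exact hT.not_anc_par hb (by rw [h]; exact .refl _)

end IsLayered

/-- The nodes `S i = i` are sources, each growing a region of radius `x`; every other node `i`
has a core vertex in the region of its source `S i`, which is also the source of its parent. -/
structure IsSourceMap (E : Finset (Sym2 V)) (l : Sym2 V → NNReal) (par : ι → ι) (root : ι)
    (K : Set V) (att : V → ι) (x : ι → ℝ) (S : ι → ι) : Prop where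
  root : S root = root
  reached : ∀ i, S i ≠ i →
    S i = S (par i) ∧ ∃ k ∈ K, att k = i ∧ coreDist E l K att (S i) k < x (S i)
  unreached : ∀ i, S i ≠ S (par i) →
    ∀ k ∈ K, att k = i → x (S (par i)) ≤ coreDist E l K att (S (par i)) k

theorem exists_isSourceMap (hT : IsTreeWith par root dep) (x : ι → ℝ) :
    ∃ S, IsSourceMap E l par root K att x S := by
  classical
  let F : ι → ι → ι := fun i a =>
    if ∃ k ∈ K, att k = i ∧ coreDist E l K att a k < x a then a else i
  let g : ℕ → ι → ι := fun n => Nat.rec (fun _ => root) (fun _ g i => F i (g (par i))) n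
  let S : ι → ι := fun i => if i = root then root else g (dep i - dep root) i
  have hdep : ∀ i, dep root ≤ dep i :=
    hT.induction le_rfl fun i hi h => h.trans (by rw [hT.dep_par i hi]; exact Nat.le_succ _)
  have hS : ∀ i, S i = g (dep i - dep root) i := by
    intro i
    by_cases hi : i = root
    · simp [S, hi, g]
    · simp [S, hi]
  have hS' : ∀ i, i ≠ root → S i = F i (S (par i)) := by
    intro i hi
    rw [hS, hS, hT.dep_par i hi, Nat.sub_add_comm (hdep _)]
  have hroot : S root = root := by simp [S]
  refine ⟨S, hroot, fun i hi => ?_, fun i hi k hk hki => ?_⟩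
  · have hir : i ≠ root := fun h => hi (h ▸ hroot)
    have h := hS' i hir
    simp only [F] at h
    split_ifs at h with hc
    · rw [h]; exact ⟨rfl, hc⟩
    · exact absurd h hi
  · have hir : i ≠ root := fun h => hi (by rw [h, hT.par_root])
    have h := hS' i hir
    simp only [F] at h
    split_ifs at h with hc
    · exact absurd h hi
    · push Not at hc
      exact hc k hk hki

namespace IsSourceMap

variable {x : ι → ℝ} {S : ι → ι}

theorem anc (hT : IsTreeWith par root dep) (hS : IsSourceMap E l par root K att x S) (i : ι) :
    Anc par (S i) i := by
  refine hT.induction (P := fun i => Anc par (S i) i) (by rw [hS.root]; exact .refl _)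
    (fun i _ ih => ?_) i
  by_cases h : S i = i
  · exact h.symm ▸ .refl _
  · exact (hS.reached i h).1 ▸ ih.of_par

theorem idem (hT : IsTreeWith par root dep) (hS : IsSourceMap E l par root K att x S) (i : ι) :
    S (S i) = S i := by
  refine hT.induction (P := fun i => S (S i) = S i) ?_ (fun i _ ih => ?_) i
  · rw [hS.root, hS.root]
  by_cases h : S i = i
  · rw [h, h]
  · rw [(hS.reached i h).1, ih]

theorem le_coreDist (hT : IsTreeWith par root dep) (hE : IsLayered E par root K att)
    (hS : IsSourceMap E l par root K att x S) (hx : ∀ i, x i ≤ 1) (ha : S a = a)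
    (hai : Anc par a i) (hi : S i ≠ a) (hz : Anc par i (att z)) :
    x a ≤ coreDist E l K att a z := by
  refine hT.induction (P := fun i => ∀ z, Anc par a i → S i ≠ a →
    Anc par i (att z) → x a ≤ coreDist E l K att a z) ?_ ?_ i z hai hi hz
  · intro z har hra
    exact absurd (by rw [hS.root, hT.anc_root_iff.1 har]) hra
  · intro i _ ih z hai hi hz
    have hne : a ≠ i := fun h => hi (h ▸ ha)
    by_cases hp : S (par i) = a
    · refine hE.le_coreDist hT hai hne hz (x := x a) (fun k hk hki => ?_) (hx a)
        (le_add_of_nonneg_right truncDist_nonneg)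
      have := hS.unreached i (fun h => hi (h.trans hp)) k hk hki
      rwa [hp] at this
    · exact ih z (hai.to_par hne) hp ((Anc.of_par (.refl _)).trans hz)

theorem eq_of_lt (hT : IsTreeWith par root dep) (hE : IsLayered E par root K att)
    (hS : IsSourceMap E l par root K att x S) (hx : ∀ i, x i ≤ 1) (ha : S a = a)
    (hz : Anc par a (att z)) (h : coreDist E l K att a z < x a) : S (att z) = a := by
  by_contra hne
  exact absurd (hS.le_coreDist hT hE hx ha hz hne (.refl _)) (not_le.2 h)

end IsSourceMap

end Layers

theorem Finset.card_le_two_of_total {α : Type*} {R : α → α → Prop} {B : Finset α}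
    (htot : ∀ a ∈ B, ∀ b ∈ B, R a b ∨ R b a)
    (hchain : ∀ a ∈ B, ∀ b ∈ B, ∀ c ∈ B, R a b → R b c → a ≠ b → b ≠ c → False) :
    B.card ≤ 2 := by
  by_contra! hB
  obtain ⟨a, ha, b, hb, c, hc, hab, hac, hbc⟩ := Finset.two_lt_card.1 hB
  rcases htot a ha b hb with h₁ | h₁ <;> rcases htot b hb c hc with h₂ | h₂ <;>
    rcases htot a ha c hc with h₃ | h₃ <;> grind

open Classical in
theorem Finset.sum_sum_filter_le_two_mul {α β : Type*} {B : Finset α} {E E' : Finset β}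
    {P : α → β → Prop} {m : β → ℝ} (hm : ∀ e, 0 ≤ m e)
    (hE' : ∀ b ∈ B, ∀ e ∈ E, P b e → e ∈ E')
    (hcard : ∀ e ∈ E', (B.filter fun b => P b e).card ≤ 2) :
    ∑ b ∈ B, ∑ e ∈ E with P b e, m e ≤ 2 * ∑ e ∈ E', m e := by
  have h₁ : ∀ b ∈ B, ∑ e ∈ E with P b e, m e ≤ ∑ e ∈ E' with P b e, m e := by
    intro b hb
    refine Finset.sum_le_sum_of_subset_of_nonneg (fun e he => ?_) fun e _ _ => hm e
    rw [Finset.mem_filter] at he ⊢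
    exact ⟨hE' b hb e he.1 he.2, he.2⟩
  refine (Finset.sum_le_sum h₁).trans ?_
  simp_rw [Finset.sum_filter]
  rw [Finset.sum_comm, Finset.mul_sum]
  refine Finset.sum_le_sum fun e he => ?_
  rw [← Finset.sum_filter, Finset.sum_const, nsmul_eq_mul]
  exact mul_le_mul_of_nonneg_right (by exact_mod_cast hcard e he) (hm e)

section Round

variable {V ι : Type*}

/-- Data of one round: every source grows a ball of radius between `1/6` and `1/3` from its core,
and hands over to its parent the vertices within distance `t < 1/6` of the parent's core. -/
structure IsRound (E : Finset (Sym2 V)) (l : Sym2 V → NNReal) (par : ι → ι) (root : ι)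
    (dep : ι → ℕ) (K : Set V) (att : V → ι) (x t : ι → ℝ) (S : ι → ι) : Prop where
  tree : IsTreeWith par root dep
  layered : IsLayered E par root K att
  source : IsSourceMap E l par root K att x S
  x_mem : ∀ i, x i ∈ Set.Ioc (1 / 6 : ℝ) (1 / 3)
  t_mem : ∀ i, t i ∈ Set.Ico (0 : ℝ) (1 / 6)

variable (E : Finset (Sym2 V)) (l : Sym2 V → NNReal) (par : ι → ι) (K : Set V) (att : V → ι)
  (x t : ι → ℝ) (S : ι → ι)

/-- Edges in the subtree of `b` having one end below and one end at or above distance `x`. -/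
def CutX (b : ι) (e : Sym2 V) : Prop :=
  (∀ u ∈ e, Anc par b (att u)) ∧ (∃ u ∈ e, coreDist E l K att b u < x b) ∧
    ∃ u ∈ e, x b ≤ coreDist E l K att b u

/-- Edges in the subtree of `b` with an end below distance `y` and an end beyond `1/6`. -/
def MassX (y : ι → ℝ) (b : ι) (e : Sym2 V) : Prop :=
  (∀ u ∈ e, Anc par b (att u)) ∧ (∃ u ∈ e, coreDist E l K att b u < y b) ∧
    ∃ u ∈ e, 1 / 6 < coreDist E l K att b u

/-- Edges touching the subtree of `b` having one end within and one end beyond distance `t` of the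
core of the parent of `b`. -/
def CutT (b : ι) (e : Sym2 V) : Prop :=
  (∃ u ∈ e, Anc par b (att u)) ∧ (∃ u ∈ e, coreDist E l K att (par b) u ≤ t b) ∧
    ∃ u ∈ e, t b < coreDist E l K att (par b) u

/-- Edges touching the subtree of `b` with an end beyond distance `y` and an end below `1/6` from
the core of the parent of `b`. -/
def MassT (y : ι → ℝ) (b : ι) (e : Sym2 V) : Prop :=
  (∃ u ∈ e, Anc par b (att u)) ∧ (∃ u ∈ e, y b < coreDist E l K att (par b) u) ∧
    ∃ u ∈ e, coreDist E l K att (par b) u < 1 / 6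

/-- The vertex lies in the ball grown by its source. -/
def Reached (z : V) : Prop := coreDist E l K att (S (att z)) z < x (S (att z))

/-- The vertex is handed over to the parent of its source. -/
def Passed (z : V) : Prop := coreDist E l K att (par (S (att z))) z ≤ t (S (att z))

variable {E l par K att x t S} {root : ι} {dep : ι → ℕ}

theorem IsLayered.entering_of_mem (hE : IsLayered E par root K att) {e : Sym2 V} (he : e ∈ E)
    {b : ι} {u v : V} (hue : u ∈ e) (hve : v ∈ e) (hu : ¬Anc par b (att u))
    (hv : Anc par b (att v)) : att v = b ∧ att u = par b ∧ u ∈ K ∧ v ∈ K := by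
  have hne : u ≠ v := fun h => hu (h ▸ hv)
  rw [(Sym2.mem_and_mem_iff hne).1 ⟨hue, hve⟩] at he
  exact hE.entering he hu hv

namespace IsRound

theorem x_le_one (hR : IsRound E l par root dep K att x t S) (i : ι) : x i ≤ 1 := by
  linarith [(hR.x_mem i).2]

theorem card_massX_le (hR : IsRound E l par root dep K att x t S) {B : Finset ι}
    (hB : ∀ b ∈ B, S b = b) {e : Sym2 V}
    [DecidablePred fun b => MassX E l par K att (fun _ => 1 / 3) b e] :
    (B.filter fun b => MassX E l par K att (fun _ => 1 / 3) b e).card ≤ 2 := by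
  refine Finset.card_le_two_of_total (R := Anc par) ?_ ?_
  · intro b hb b' hb'
    have h := (Finset.mem_filter.1 hb).2
    have h' := (Finset.mem_filter.1 hb').2
    obtain ⟨u, hu, -⟩ := h.2.1
    exact (h.1 u hu).total (h'.1 u hu)
  · intro b₁ h₁ b₂ h₂ b₃ h₃ h₁₂ h₂₃ hne hne'
    rw [Finset.mem_filter] at h₁ h₂ h₃
    obtain ⟨z, hz, hlt⟩ := h₁.2.2.1
    have hz3 := h₃.2.1 z hz
    have hle : x b₁ + x b₂ ≤ coreDist E l K att b₁ z := by
      refine hR.layered.le_coreDist hR.tree h₁₂ hne (h₂₃.trans hz3) (x := x b₁)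
        (fun k _ hk => ?_) (by linarith [(hR.x_mem b₁).2, (hR.x_mem b₂).2])
        (add_le_add_right ?_ _)
      · exact hR.source.le_coreDist hR.tree hR.layered hR.x_le_one (hB _ h₁.1) h₁₂
          (by rw [hB _ h₂.1]; exact hne.symm) (hk ▸ .refl _)
      · exact hR.source.le_coreDist hR.tree hR.layered hR.x_le_one (hB _ h₂.1) h₂₃
          (by rw [hB _ h₃.1]; exact hne'.symm) hz3
    linarith [(hR.x_mem b₁).1, (hR.x_mem b₂).1]

theorem card_massT_le (hR : IsRound E l par root dep K att x t S) {B : Finset ι}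
    (hB : ∀ b ∈ B, S b = b) {e : Sym2 V} (he : e ∈ E)
    [DecidablePred fun b => MassT E l par K att (fun _ => 0) b e] :
    (B.filter fun b => MassT E l par K att (fun _ => 0) b e).card ≤ 2 := by
  refine Finset.card_le_two_of_total (R := Anc par) ?_ ?_
  · intro b hb b' hb'
    obtain ⟨u, hu, hbu⟩ := (Finset.mem_filter.1 hb).2.1
    obtain ⟨v, hv, hbv⟩ := (Finset.mem_filter.1 hb').2.1
    by_cases h : Anc par b (att v)
    · exact h.total hbv
    · obtain ⟨-, h', -⟩ := hR.layered.entering_of_mem he hv hu h hbu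
      exact .inr (Anc.of_par (h' ▸ hbv))
  · intro b₁ h₁ b₂ h₂ b₃ h₃ h₁₂ h₂₃ hne hne'
    rw [Finset.mem_filter] at h₁ h₂ h₃
    obtain ⟨z, hz, hlt⟩ := h₁.2.2.2
    obtain ⟨u, hu, h3u⟩ := h₃.2.1
    have hz2 : Anc par b₂ (att z) := by
      by_cases h : Anc par b₃ (att z)
      · exact h₂₃.trans h
      · obtain ⟨-, h', -⟩ := hR.layered.entering_of_mem he hz hu h h3u
        exact h' ▸ h₂₃.to_par hne'
    have := hR.source.le_coreDist hR.tree hR.layered hR.x_le_one (hB _ h₁.1) h₁₂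
      (by rw [hB _ h₂.1]; exact hne.symm) hz2
    linarith [(hR.x_mem b₁).1, hR.layered.coreDist_le_par (l := l) hR.tree (h₁₂.trans hz2)]

theorem reached_of_passed (hR : IsRound E l par root dep K att x t S) {z : V}
    (h : Passed E l par K att t S z) : Reached E l K att x S z := by
  have h₁ := hR.layered.coreDist_le_par (l := l) hR.tree (hR.source.anc hR.tree (att z))
  have h₂ := (hR.t_mem (S (att z))).2
  have h₃ := (hR.x_mem (S (att z))).1
  unfold Passed at h
  unfold Reached
  linarith

theorem exists_reached (hR : IsRound E l par root dep K att x t S) {k : V} (hk : k ∈ K) :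
    ∃ k' ∈ K, att k' = att k ∧ Reached E l K att x S k' := by
  by_cases h : S (att k) = att k
  · have h0 : coreDist E l K att (S (att k)) k = 0 := truncDist_eq_zero ⟨hk, h.symm⟩
    refine ⟨k, hk, rfl, ?_⟩
    unfold Reached
    linarith [(hR.x_mem (S (att k))).1]
  · obtain ⟨-, k', hk', hatt, hlt⟩ := hR.source.reached _ h
    exact ⟨k', hk', hatt, by unfold Reached; rwa [hatt]⟩

/-- Across an edge that is not cut and descends to a node with a new source, the lower end is
passed to the upper end's node and the upper end is not reached. -/
theorem passed_and_not_reached (hR : IsRound E l par root dep K att x t S) {u v : V}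
    (he : s(u, v) ∈ E) (hne : S (att u) ≠ S (att v)) (hu : u ∈ K) (hv : v ∈ K)
    (huv : att v = par (att u)) (hX : ¬CutX E l par K att x (S (att v)) s(u, v))
    (hT : ¬CutT E l par K att t (S (att u)) s(u, v)) :
    Passed E l par K att t S u ∧ ¬Reached E l K att x S v ∧ par (S (att u)) = att v := by
  have hsrc : S (att u) = att u := by
    by_contra h
    exact hne (huv ▸ (hR.source.reached _ h).1)
  have hpar : par (S (att u)) = att v := by rw [hsrc, huv]
  have hv0 : coreDist E l K att (par (S (att u))) v = 0 := truncDist_eq_zero ⟨hv, hpar.symm⟩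
  refine ⟨?_, fun hr => hX ?_, hpar⟩
  · by_contra h
    unfold Passed at h
    push Not at h
    refine hT ⟨⟨u, Sym2.mem_mk_left _ _, hR.source.anc hR.tree _⟩,
      ⟨v, Sym2.mem_mk_right _ _, ?_⟩, ⟨u, Sym2.mem_mk_left _ _, h⟩⟩
    rw [hv0]
    exact (hR.t_mem _).1
  · have hanc := hR.source.anc hR.tree (att v)
    refine ⟨?_, ⟨v, Sym2.mem_mk_right _ _, hr⟩, ⟨u, Sym2.mem_mk_left _ _, ?_⟩⟩
    · intro z hz
      rcases Sym2.mem_iff.1 hz with rfl | rfl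
      · exact Anc.of_par (huv ▸ hanc)
      · exact hanc
    · have := hR.source.unreached (att u) (huv ▸ hne) u hu rfl
      rwa [← huv] at this

theorem uncut_edge (hR : IsRound E l par root dep K att x t S) {u v : V} (he : s(u, v) ∈ E)
    (hX : ∀ z, ¬CutX E l par K att x (S (att z)) s(u, v))
    (hT : ∀ z, ¬CutT E l par K att t (S (att z)) s(u, v)) :
    (S (att u) = S (att v) ∧ (Reached E l K att x S u ↔ Reached E l K att x S v) ∧
      (Passed E l par K att t S u ↔ Passed E l par K att t S v)) ∨
    (Passed E l par K att t S u ∧ ¬Reached E l K att x S v ∧ par (S (att u)) = att v) ∨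
    (Passed E l par K att t S v ∧ ¬Reached E l K att x S u ∧ par (S (att v)) = att u) := by
  by_cases hs : S (att u) = S (att v)
  · have hau := hR.source.anc hR.tree (att u)
    have hav := hR.source.anc hR.tree (att v)
    have hX := hX u
    have hT := hT u
    unfold CutX at hX
    unfold CutT at hT
    unfold Reached Passed
    rw [← hs] at hav ⊢
    refine .inl ⟨rfl, ?_, ?_⟩
    · simp only [Sym2.mem_iff, forall_eq_or_imp, forall_eq, exists_eq_or_imp, exists_eq_left, hau,
        hav, true_and, and_self] at hX
      grind
    · simp only [Sym2.mem_iff, exists_eq_or_imp, exists_eq_left, hau, true_or, true_and] at hT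
      grind
  · right
    rcases hR.layered.edge u v he with h | ⟨hu, hv, h | h⟩
    · exact absurd (by rw [h]) hs
    · right
      rw [Sym2.eq_swap] at he
      refine hR.passed_and_not_reached he (Ne.symm hs) hv hu h ?_ ?_
      · rw [Sym2.eq_swap]; exact hX u
      · rw [Sym2.eq_swap]; exact hT v
    · exact .inl (hR.passed_and_not_reached he hs hu hv h (hX v) (hT u))

/-- An uncut edge with mass in the growth region of a source has a finished end. -/
theorem exists_finished_of_massX (hR : IsRound E l par root dep K att x t S) {b : ι}
    (hb : S b = b) {e : Sym2 V} (hT : ¬CutT E l par K att t b e)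
    (h : MassX E l par K att x b e) :
    ∃ u ∈ e, Reached E l K att x S u ∧ ¬Passed E l par K att t S u := by
  obtain ⟨hanc, ⟨u, hu, hlt⟩, v, hv, hgt⟩ := h
  have hbu := hR.source.eq_of_lt hR.tree hR.layered hR.x_le_one hb (hanc u hu) hlt
  refine ⟨u, hu, by unfold Reached; rwa [hbu], fun hp => hT ?_⟩
  unfold Passed at hp
  rw [hbu] at hp
  refine ⟨⟨u, hu, hanc u hu⟩, ⟨u, hu, hp⟩, ⟨v, hv, ?_⟩⟩
  linarith [hR.layered.coreDist_le_par (l := l) hR.tree (hanc v hv), (hR.t_mem b).2]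

theorem exists_finished_of_massT (hR : IsRound E l par root dep K att x t S) {b : ι}
    (hb : S b = b) {e : Sym2 V} (he : e ∈ E) (hT : ¬CutT E l par K att t b e)
    (h : MassT E l par K att t b e) :
    ∃ u ∈ e, Reached E l K att x S u ∧ ¬Passed E l par K att t S u := by
  obtain ⟨⟨u, hu, hanc⟩, hgt, w, hw, hlt⟩ := h
  have hfar : t b < coreDist E l K att (par b) w := by
    by_contra! hle
    exact hT ⟨⟨u, hu, hanc⟩, ⟨w, hw, hle⟩, hgt⟩
  by_cases hwb : Anc par b (att w)
  · have hltx : coreDist E l K att b w < x b := by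
      linarith [hR.layered.coreDist_le_par (l := l) hR.tree hwb, (hR.x_mem b).1]
    have hbw := hR.source.eq_of_lt hR.tree hR.layered hR.x_le_one hb hwb hltx
    refine ⟨w, hw, by unfold Reached; rwa [hbw], fun hp => ?_⟩
    unfold Passed at hp
    rw [hbw] at hp
    exact absurd hp (not_le.2 hfar)
  · obtain ⟨-, hwp, hwK, -⟩ := hR.layered.entering_of_mem he hw hu hwb hanc
    have h0 : coreDist E l K att (par b) w = 0 := truncDist_eq_zero ⟨hwK, hwp⟩
    linarith [(hR.t_mem b).1]

end IsRound

end Round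

section RoundCost

variable {V ι : Type*} {E : Finset (Sym2 V)} {l : Sym2 V → NNReal} {par : ι → ι} {K : Set V}
  {att : V → ι} {η κ : ℝ}

open Classical in
theorem exists_radii (c : Sym2 V → NNReal) (hκ : 0 ≤ κ) (hexp : 1 + η < η * Real.exp (κ / 6)) :
    ∃ x : ι → ℝ, ∀ b, x b ∈ Set.Ioc (1 / 6 : ℝ) (1 / 3) ∧
      ∑ e ∈ E with CutX E l par K att x b e, (c e : ℝ) ≤
        κ * (∑ e ∈ E with MassX E l par K att x b e, (c e * l e : ℝ) +
          η * ∑ e ∈ E with MassX E l par K att (fun _ => 1 / 3) b e, (c e * l e : ℝ)) := by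
  have h : ∀ b : ι, ∃ x ∈ Set.Ioc (1 / 6 : ℝ) (1 / 3),
      ∑ e ∈ E with CutX E l par K att (fun _ => x) b e, (c e : ℝ) ≤
        κ * (∑ e ∈ E with MassX E l par K att (fun _ => x) b e, (c e * l e : ℝ) +
          η * ∑ e ∈ E with MassX E l par K att (fun _ => 1 / 3) b e, (c e * l e : ℝ)) := by
    intro b
    have := exists_edge_cut_le (E := E.filter fun e => ∀ u ∈ e, Anc par b (att u)) (l := l)
      (h := coreDist E l K att b) c
      (fun u v he => truncDist_le_add (Finset.mem_filter.1 he).1)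
      (a := 1 / 6) (b := 1 / 3) (η := η) (by norm_num) hκ (by convert hexp using 3; ring)
    simp only [Finset.filter_filter] at this
    unfold CutX MassX
    convert this
  choose x hx hle using h
  exact ⟨x, fun b => ⟨hx b, hle b⟩⟩

open Classical in
theorem exists_pass_radii (c : Sym2 V → NNReal) (hκ : 0 ≤ κ)
    (hexp : 1 + η < η * Real.exp (κ / 6)) :
    ∃ t : ι → ℝ, ∀ b, t b ∈ Set.Ico (0 : ℝ) (1 / 6) ∧
      ∑ e ∈ E with CutT E l par K att t b e, (c e : ℝ) ≤
        κ * (∑ e ∈ E with MassT E l par K att t b e, (c e * l e : ℝ) +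
          η * ∑ e ∈ E with MassT E l par K att (fun _ => 0) b e, (c e * l e : ℝ)) := by
  have h : ∀ b : ι, ∃ t ∈ Set.Ico (0 : ℝ) (1 / 6),
      ∑ e ∈ E with CutT E l par K att (fun _ => t) b e, (c e : ℝ) ≤
        κ * (∑ e ∈ E with MassT E l par K att (fun _ => t) b e, (c e * l e : ℝ) +
          η * ∑ e ∈ E with MassT E l par K att (fun _ => 0) b e, (c e * l e : ℝ)) := by
    intro b
    have := exists_edge_cut_le_above (E := E.filter fun e => ∃ u ∈ e, Anc par b (att u)) (l := l)
      (h := coreDist E l K att (par b)) c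
      (fun u v he => truncDist_le_add (Finset.mem_filter.1 he).1)
      (a := 0) (b := 1 / 6) (η := η) (by norm_num) hκ (by convert hexp using 3; ring)
    simp only [Finset.filter_filter] at this
    unfold CutT MassT
    convert this
  choose t ht hle using h
  exact ⟨t, fun b => ⟨ht b, hle b⟩⟩

variable {x t : ι → ℝ} {S : ι → ι} {root : ι} {dep : ι → ℕ}

theorem MassX.mono {y y' : ι → ℝ} {b : ι} {e : Sym2 V} (hy : y b ≤ y' b)
    (h : MassX E l par K att y b e) : MassX E l par K att y' b e := by
  obtain ⟨h₁, ⟨u, hu, hlt⟩, h₃⟩ := h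
  exact ⟨h₁, ⟨u, hu, hlt.trans_le hy⟩, h₃⟩

theorem MassT.mono {y y' : ι → ℝ} {b : ι} {e : Sym2 V} (hy : y' b ≤ y b)
    (h : MassT E l par K att y b e) : MassT E l par K att y' b e := by
  obtain ⟨h₁, ⟨u, hu, hlt⟩, h₃⟩ := h
  exact ⟨h₁, ⟨u, hu, hy.trans_lt hlt⟩, h₃⟩

open Classical in
/-- The capacity cut in one round is paid for by the edges that leave the instance. -/
theorem IsRound.sum_cut_le (hR : IsRound E l par root dep K att x t S) (c : Sym2 V → NNReal)
    (hκ : 0 ≤ κ) (hη : 0 ≤ η) {B : Finset ι} (hB : ∀ b ∈ B, S b = b)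
    (hx : ∀ b, ∑ e ∈ E with CutX E l par K att x b e, (c e : ℝ) ≤
        κ * (∑ e ∈ E with MassX E l par K att x b e, (c e * l e : ℝ) +
          η * ∑ e ∈ E with MassX E l par K att (fun _ => 1 / 3) b e, (c e * l e : ℝ)))
    (ht : ∀ b, ∑ e ∈ E with CutT E l par K att t b e, (c e : ℝ) ≤
        κ * (∑ e ∈ E with MassT E l par K att t b e, (c e * l e : ℝ) +
          η * ∑ e ∈ E with MassT E l par K att (fun _ => 0) b e, (c e * l e : ℝ)))
    {E₁ : Finset (Sym2 V)} (hE₁ : E₁ ⊆ E) (hcut : ∀ e ∈ E₁, ∀ b ∈ B, ¬CutT E l par K att t b e)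
    (hfin : ∀ e ∈ E₁, ∀ u ∈ e, Reached E l K att x S u → Passed E l par K att t S u) :
    ∑ e ∈ E with ∃ b ∈ B, CutX E l par K att x b e ∨ CutT E l par K att t b e, (c e : ℝ) ≤
      κ * (4 * (∑ e ∈ E, (c e * l e : ℝ) - ∑ e ∈ E₁, (c e * l e : ℝ)) +
        4 * η * ∑ e ∈ E, (c e * l e : ℝ)) := by
  have hm : ∀ e : Sym2 V, 0 ≤ (c e * l e : ℝ) := fun e => (c e * l e).2
  have hdiff : ∑ e ∈ E, (c e * l e : ℝ) - ∑ e ∈ E₁, (c e * l e : ℝ) =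
      ∑ e ∈ E \ E₁, (c e * l e : ℝ) := by
    rw [← Finset.sum_sdiff hE₁]; ring
  have hx₁ : ∑ b ∈ B, ∑ e ∈ E with MassX E l par K att x b e, (c e * l e : ℝ) ≤
      2 * ∑ e ∈ E \ E₁, (c e * l e : ℝ) := by
    refine Finset.sum_sum_filter_le_two_mul hm (fun b hb e he h => ?_) fun e _ => ?_
    · refine Finset.mem_sdiff.2 ⟨he, fun he₁ => ?_⟩
      obtain ⟨u, hu, hr, hp⟩ := hR.exists_finished_of_massX (hB b hb) (hcut e he₁ b hb) h
      exact hp (hfin e he₁ u hu hr)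
    · refine le_trans (Finset.card_le_card fun b hb => ?_) (hR.card_massX_le hB (e := e))
      rw [Finset.mem_filter] at hb ⊢
      exact ⟨hb.1, hb.2.mono (hR.x_mem b).2⟩
  have hx₂ : ∑ b ∈ B, ∑ e ∈ E with MassX E l par K att (fun _ => 1 / 3) b e, (c e * l e : ℝ) ≤
      2 * ∑ e ∈ E, (c e * l e : ℝ) :=
    Finset.sum_sum_filter_le_two_mul hm (fun b hb e he h => he) fun e _ => hR.card_massX_le hB
  have ht₁ : ∑ b ∈ B, ∑ e ∈ E with MassT E l par K att t b e, (c e * l e : ℝ) ≤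
      2 * ∑ e ∈ E \ E₁, (c e * l e : ℝ) := by
    refine Finset.sum_sum_filter_le_two_mul hm (fun b hb e he h => ?_) fun e he => ?_
    · refine Finset.mem_sdiff.2 ⟨he, fun he₁ => ?_⟩
      obtain ⟨u, hu, hr, hp⟩ := hR.exists_finished_of_massT (hB b hb) he (hcut e he₁ b hb) h
      exact hp (hfin e he₁ u hu hr)
    · refine le_trans (Finset.card_le_card fun b hb => ?_)
        (hR.card_massT_le hB (Finset.mem_sdiff.1 he).1)
      rw [Finset.mem_filter] at hb ⊢
      exact ⟨hb.1, hb.2.mono (hR.t_mem b).1⟩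
  have ht₂ : ∑ b ∈ B, ∑ e ∈ E with MassT E l par K att (fun _ => 0) b e, (c e * l e : ℝ) ≤
      2 * ∑ e ∈ E, (c e * l e : ℝ) :=
    Finset.sum_sum_filter_le_two_mul hm (fun b hb e he h => he) fun e he => hR.card_massT_le hB he
  have hsum : ∑ e ∈ E with ∃ b ∈ B, CutX E l par K att x b e ∨ CutT E l par K att t b e,
      (c e : ℝ) ≤
      ∑ b ∈ B, (∑ e ∈ E with CutX E l par K att x b e, (c e : ℝ) +
        ∑ e ∈ E with CutT E l par K att t b e, (c e : ℝ)) := by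
    simp_rw [Finset.sum_filter]
    simp_rw [← Finset.sum_add_distrib]
    rw [Finset.sum_comm]
    refine Finset.sum_le_sum fun e _ => ?_
    have hnn : ∀ b ∈ B, (0 : ℝ) ≤ (if CutX E l par K att x b e then (c e : ℝ) else 0) +
        if CutT E l par K att t b e then (c e : ℝ) else 0 := fun b _ => by positivity
    split_ifs with h
    · obtain ⟨b, hb, h⟩ := h
      refine le_trans ?_ (Finset.single_le_sum hnn hb)
      rcases h with h | h
      · rw [if_pos h]
        exact le_add_of_nonneg_right (by positivity)
      · rw [if_pos h]
        exact le_add_of_nonneg_left (by positivity)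
    · exact Finset.sum_nonneg hnn
  refine hsum.trans ((Finset.sum_le_sum fun b _ => add_le_add (hx b) (ht b)).trans ?_)
  rw [hdiff]
  simp_rw [← mul_add, ← Finset.mul_sum, Finset.sum_add_distrib, ← Finset.mul_sum]
  refine mul_le_mul_of_nonneg_left ?_ hκ
  have h₁ := mul_le_mul_of_nonneg_left hx₂ hη
  have h₂ := mul_le_mul_of_nonneg_left ht₂ hη
  linarith

end RoundCost

theorem sum_capacity_union_le {ε : Type*} [DecidableEq ε] (c : ε → NNReal) (A B : Finset ε) :
    ∑ e ∈ A ∪ B, (c e : ℝ) ≤ ∑ e ∈ A, (c e : ℝ) + ∑ e ∈ B, (c e : ℝ) := by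
  rw [← Finset.sum_union_inter]
  exact le_add_of_nonneg_right (Finset.sum_nonneg fun e _ => (c e).2)

section Attachment

variable {V ι : Type*} {Eg E : Finset (Sym2 V)} {l : Sym2 V → NNReal} {bagOf : V → ι}
  {par : ι → ι} {root : ι} {dep : ι → ℕ} {K : Set V} {att : V → ι} {w : ℕ} {η κ : ℝ}

/-- The vertex `z` lies within distance `1/3` of the bag `i`. -/
def NearBag (Eg : Finset (Sym2 V)) (l : Sym2 V → NNReal) (bagOf : V → ι) (i : ι) (z : V) : Prop :=
  ∃ d ≤ (1 / 3 : ℝ), Near Eg l {s | bagOf s = i} z d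

/-- An instance with at most `w` core vertices in every bag, where every vertex is attached to a
nearby bag. -/
structure IsState (Eg : Finset (Sym2 V)) (l : Sym2 V → NNReal) (bagOf : V → ι) (par : ι → ι)
    (root : ι) (w : ℕ) (E : Finset (Sym2 V)) (K : Set V) (att : V → ι) : Prop where
  subset : E ⊆ Eg
  layered : IsLayered E par root K att
  bag : ∀ k ∈ K, bagOf k = att k
  card : ∀ i, {k | k ∈ K ∧ att k = i}.ncard ≤ w
  near : ∀ z, NearBag Eg l bagOf (att z) z

theorem IsState.nearBag (hs : IsState Eg l bagOf par root w E K att) {b : ι} {z : V}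
    (h : coreDist E l K att b z < 1 / 3) : NearBag Eg l bagOf b z := by
  obtain ⟨d, hd, hnear⟩ := exists_near_lt (by norm_num) h
  exact ⟨d, hd.le, hnear.mono hs.subset fun k hk => (hs.bag k hk.1).trans hk.2⟩

open Classical in
theorem IsRound.next_layered {x t : ι → ℝ} {S : ι → ι}
    (hR : IsRound E l par root dep K att x t S) {E₁ : Finset (Sym2 V)} (hE₁ : E₁ ⊆ E)
    (hX : ∀ e ∈ E₁, ∀ z, ¬CutX E l par K att x (S (att z)) e)
    (hT : ∀ e ∈ E₁, ∀ z, ¬CutT E l par K att t (S (att z)) e)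
    (hfin : ∀ e ∈ E₁, ∀ u ∈ e, Reached E l K att x S u → Passed E l par K att t S u) :
    IsLayered E₁ par root {k | k ∈ K ∧ ¬Reached E l K att x S k}
      (fun z => if Passed E l par K att t S z then par (S (att z)) else att z) := by
  refine ⟨fun u v he => ?_, fun k hk => ?_⟩
  · have hu := hfin _ he u (Sym2.mem_mk_left _ _)
    have hv := hfin _ he v (Sym2.mem_mk_right _ _)
    have hpu := hR.reached_of_passed (z := u)
    have hpv := hR.reached_of_passed (z := v)
    have hadj := hR.layered.edge u v (hE₁ he)
    rcases hR.uncut_edge (hE₁ he) (hX _ he) (hT _ he) with ⟨hs, hr, hp⟩ | ⟨hp, hr, hpar⟩ |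
      ⟨hp, hr, hpar⟩
    · simp only [Set.mem_ofPred_eq]
      rw [hs]
      grind
    · rw [if_pos hp, if_neg fun h => hr (hpv h)]
      exact .inl hpar
    · rw [if_pos hp, if_neg fun h => hr (hpu h)]
      exact .inl hpar.symm
  · rw [if_neg fun h => hk.2 (hR.reached_of_passed h)]
    exact hR.layered.ne_root k hk.1

open Classical in
theorem IsState.round [Finite V] (hT : IsTreeWith par root dep) (c : Sym2 V → NNReal)
    (hκ : 0 ≤ κ) (hη : 0 ≤ η) (hexp : 1 + η < η * Real.exp (κ / 6))
    (hs : IsState Eg l bagOf par root (w + 1) E K att) :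
    ∃ (X E₁ : Finset (Sym2 V)) (K₁ : Set V) (att₁ : V → ι) (F : V → Prop) (f : V → ι),
      E₁ ⊆ E ∧ IsState Eg l bagOf par root w E₁ K₁ att₁ ∧
      (∀ u v, s(u, v) ∈ E → s(u, v) ∉ X → (F u ∧ F v ∧ f u = f v) ∨
        (¬F u ∧ ¬F v ∧ s(u, v) ∈ E₁)) ∧
      (∀ z, F z → NearBag Eg l bagOf (f z) z) ∧
      ∑ e ∈ E with e ∈ X, (c e : ℝ) ≤
        κ * (4 * (∑ e ∈ E, (c e * l e : ℝ) - ∑ e ∈ E₁, (c e * l e : ℝ)) +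
          4 * η * ∑ e ∈ E, (c e * l e : ℝ)) := by
  have := Fintype.ofFinite V
  obtain ⟨x, hx⟩ := exists_radii (E := E) (l := l) (par := par) (K := K) (att := att) c hκ hexp
  obtain ⟨t, ht⟩ := exists_pass_radii (E := E) (l := l) (par := par) (K := K) (att := att) c hκ
    hexp
  obtain ⟨S, hS⟩ := exists_isSourceMap (E := E) (l := l) (K := K) (att := att) hT x
  have hR : IsRound E l par root dep K att x t S :=
    ⟨hT, hs.layered, hS, fun i => (hx i).1, fun i => (ht i).1⟩
  let B : Finset ι := Finset.univ.image fun z => S (att z)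
  have hB : ∀ b ∈ B, S b = b := by
    intro b hb
    obtain ⟨z, -, rfl⟩ := Finset.mem_image.1 hb
    exact hS.idem hT _
  have hmemB : ∀ z, S (att z) ∈ B := fun z => Finset.mem_image_of_mem _ (Finset.mem_univ z)
  let F : V → Prop := fun z => Reached E l K att x S z ∧ ¬Passed E l par K att t S z
  let X := E.filter fun e => ∃ b ∈ B, CutX E l par K att x b e ∨ CutT E l par K att t b e
  have hX : ∀ e ∈ E, e ∉ X → ∀ b ∈ B, ¬CutX E l par K att x b e ∧ ¬CutT E l par K att t b e := by
    intro e he heX b hb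
    rw [← not_or]
    exact fun h => heX (Finset.mem_filter.2 ⟨he, b, hb, h⟩)
  let E₁ := E.filter fun e => e ∉ X ∧ ∀ u ∈ e, ¬F u
  have hE₁ : E₁ ⊆ E := Finset.filter_subset _ _
  have hE₁X : ∀ e ∈ E₁, ∀ b ∈ B, ¬CutX E l par K att x b e ∧ ¬CutT E l par K att t b e :=
    fun e he => hX e (hE₁ he) (Finset.mem_filter.1 he).2.1
  have hfin : ∀ e ∈ E₁, ∀ u ∈ e, Reached E l K att x S u → Passed E l par K att t S u := by
    intro e he u hu hr
    by_contra hp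
    exact (Finset.mem_filter.1 he).2.2 u hu ⟨hr, hp⟩
  refine ⟨X, E₁, {k | k ∈ K ∧ ¬Reached E l K att x S k},
    fun z => if Passed E l par K att t S z then par (S (att z)) else att z, F,
    fun z => S (att z), hE₁, ⟨hE₁.trans hs.subset, ?_, ?_, ?_, ?_⟩, ?_, ?_, ?_⟩
  · exact hR.next_layered hE₁ (fun e he z => (hE₁X e he _ (hmemB z)).1)
      (fun e he z => (hE₁X e he _ (hmemB z)).2) hfin
  · intro k hk
    rw [if_neg fun h => hk.2 (hR.reached_of_passed h)]
    exact hs.bag k hk.1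
  · intro i
    have hsub : {k | k ∈ {k | k ∈ K ∧ ¬Reached E l K att x S k} ∧
        (if Passed E l par K att t S k then par (S (att k)) else att k) = i} ⊆
        {k | k ∈ K ∧ att k = i ∧ ¬Reached E l K att x S k} := by
      rintro k ⟨hk, hki⟩
      rw [if_neg fun h => hk.2 (hR.reached_of_passed h)] at hki
      exact ⟨hk.1, hki, hk.2⟩
    refine (Set.ncard_le_ncard hsub (Set.toFinite _)).trans ?_
    by_cases hne : ∃ k ∈ K, att k = i
    · obtain ⟨k, hk, rfl⟩ := hne
      obtain ⟨k', hk', hatt, hr⟩ := hR.exists_reached hk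
      refine Nat.le_of_lt_succ (lt_of_lt_of_le ?_ (hs.card (att k)))
      refine Set.ncard_lt_ncard ⟨fun y hy => ⟨hy.1, hy.2.1⟩, fun h => ?_⟩ (Set.toFinite _)
      exact (h ⟨hk', hatt⟩).2.2 hr
    · have : {k | k ∈ K ∧ att k = i ∧ ¬Reached E l K att x S k} = ∅ :=
        Set.eq_empty_of_forall_notMem fun k hk => hne ⟨k, hk.1, hk.2.1⟩
      rw [this, Set.ncard_empty]
      exact Nat.zero_le _
  · intro z
    split_ifs with h
    · refine hs.nearBag (lt_of_le_of_lt h ?_)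
      linarith [(hR.t_mem (S (att z))).2]
    · exact hs.near z
  · intro u v he heX
    have hcut := hX _ he heX
    have hpu := hR.reached_of_passed (z := u)
    have hpv := hR.reached_of_passed (z := v)
    have hedge := hR.uncut_edge he (fun z => (hcut _ (hmemB z)).1) fun z => (hcut _ (hmemB z)).2
    have hmem : ¬F u → ¬F v → s(u, v) ∈ E₁ := by
      intro hu hv
      refine Finset.mem_filter.2 ⟨he, heX, fun y hy => ?_⟩
      rcases Sym2.mem_iff.1 hy with rfl | rfl
      exacts [hu, hv]
    by_cases hFu : F u
    · left
      rcases hedge with ⟨hs, hr, hp⟩ | ⟨hp, -, -⟩ | ⟨-, hr, -⟩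
      · exact ⟨hFu, ⟨hr.1 hFu.1, fun h => hFu.2 (hp.2 h)⟩, hs⟩
      · exact absurd hp hFu.2
      · exact absurd hFu.1 hr
    · right
      have hFv : ¬F v := by
        rcases hedge with ⟨hs, hr, hp⟩ | ⟨-, hr, -⟩ | ⟨hp, -, -⟩
        · exact fun h => hFu ⟨hr.2 h.1, fun h' => h.2 (hp.1 h')⟩
        · exact fun h => hr h.1
        · exact fun h => h.2 hp
      exact ⟨hFu, hFv, hmem hFu hFv⟩
  · intro z hz
    exact hs.nearBag (lt_of_lt_of_le hz.1 (hR.x_mem _).2)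
  · have hEX : (E.filter fun e => e ∈ X) = X := by
      rw [Finset.filter_mem_eq_inter, Finset.inter_eq_right]
      exact Finset.filter_subset _ _
    rw [hEX]
    exact hR.sum_cut_le c hκ hη hB (fun b => (hx b).2) (fun b => (ht b).2) hE₁
      (fun e he b hb => (hE₁X e he b hb).2) hfin

/-- Cutting a small capacity, all vertices can be assigned to nearby bags such that uncut edges
have both ends assigned to the same bag. -/
theorem IsState.exists_assignment [Finite V] (hT : IsTreeWith par root dep) (c : Sym2 V → NNReal)
    (hκ : 0 ≤ κ) (hη : 0 ≤ η) (hexp : 1 + η < η * Real.exp (κ / 6))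
    (hs : IsState Eg l bagOf par root w E K att) :
    ∃ (C : Finset (Sym2 V)) (f : V → ι), C ⊆ E ∧
      (∀ u v, s(u, v) ∈ E → s(u, v) ∉ C → f u = f v) ∧ (∀ z, NearBag Eg l bagOf (f z) z) ∧
      ∑ e ∈ C, (c e : ℝ) ≤ κ * (4 + 4 * η * w) * ∑ e ∈ E, (c e * l e : ℝ) := by
  classical
  have hm : ∀ e : Sym2 V, 0 ≤ (c e * l e : ℝ) := fun e => (c e * l e).2
  induction w generalizing E K att with
  | zero =>
    refine ⟨∅, att, Finset.empty_subset _, fun u v he _ => ?_, hs.near, ?_⟩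
    · rcases hs.layered.edge u v he with h | ⟨hu, -⟩
      · exact h
      · have h0 := Nat.le_zero.1 (hs.card (att u))
        rw [Set.ncard_eq_zero] at h0
        exact (h0.subset ⟨hu, rfl⟩).elim
    · rw [Finset.sum_empty]
      have := Finset.sum_nonneg fun e (_ : e ∈ E) => hm e
      positivity
  | succ w ih =>
    obtain ⟨X, E₁, K₁, att₁, F, f, hE₁, hs₁, hedge, hnear, hcost⟩ := hs.round hT c hκ hη hexp
    obtain ⟨C, f₁, hC, hedge₁, hnear₁, hcost₁⟩ := ih hs₁
    refine ⟨E.filter (· ∈ X) ∪ C, fun z => if F z then f z else f₁ z,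
      Finset.union_subset (Finset.filter_subset _ _) (hC.trans hE₁), ?_, ?_, ?_⟩
    · intro u v he hn
      rw [Finset.mem_union, not_or, Finset.mem_filter] at hn
      rcases hedge u v he fun h => hn.1 ⟨he, h⟩ with ⟨hu, hv, h⟩ | ⟨hu, hv, h⟩
      · simp only [if_pos hu, if_pos hv, h]
      · simp only [if_neg hu, if_neg hv, hedge₁ u v h hn.2]
    · intro z
      simp only
      split_ifs with h
      exacts [hnear z h, hnear₁ z]
    · have hle : ∑ e ∈ E₁, (c e * l e : ℝ) ≤ ∑ e ∈ E, (c e * l e : ℝ) :=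
        Finset.sum_le_sum_of_subset_of_nonneg hE₁ fun e _ _ => hm e
      have hunion := sum_capacity_union_le c (E.filter (· ∈ X)) C
      have hκηw : 0 ≤ κ * (4 * η * w) := by positivity
      have := mul_le_mul_of_nonneg_left hle hκηw
      push_cast
      linarith

end Attachment

section Assembly

variable {V ι : Type*} {E : Finset (Sym2 V)} {l : Sym2 V → NNReal} {η κ : ℝ}

/-- Cutting a small capacity, all vertices can be assigned to one of `k` centres each, such that
uncut edges have both ends assigned to the same centre. -/
theorem exists_center_assignment (c : Sym2 V → NNReal) (hκ : 0 ≤ κ) (hη : 0 ≤ η)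
    (hexp : 1 + η < η * Real.exp (κ / 6)) (h : ℕ → V → ℝ) (k : ℕ)
    (hL : ∀ j u v, s(u, v) ∈ E → h j v ≤ h j u + l s(u, v)) :
    ∃ (C : Finset (Sym2 V)) (J : V → ℕ), C ⊆ E ∧
      (∀ u v, s(u, v) ∈ E → s(u, v) ∉ C → J u = J v) ∧
      (∀ z, (∃ j < k, h j z ≤ 1 / 3) → J z < k ∧ h (J z) z < 1 / 2) ∧
      ∑ e ∈ C, (c e : ℝ) ≤ κ * (1 + η * k) * ∑ e ∈ E, (c e * l e : ℝ) := by
  classical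
  have hm : ∀ e : Sym2 V, 0 ≤ (c e * l e : ℝ) := fun e => (c e * l e).2
  induction k generalizing E with
  | zero =>
    refine ⟨∅, fun _ => 0, Finset.empty_subset _, fun _ _ _ _ => rfl, ?_, ?_⟩
    · rintro z ⟨j, hj, -⟩
      exact absurd hj (Nat.not_lt_zero _)
    · rw [Finset.sum_empty]
      have := Finset.sum_nonneg fun e (_ : e ∈ E) => hm e
      positivity
  | succ k ih =>
    obtain ⟨x, hx, hcut⟩ := exists_edge_cut_le c (hL k) (a := 1 / 3) (b := 1 / 2) (η := η)
      (by norm_num) hκ (by convert hexp using 3; ring)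
    have hE₁ : (E.filter fun e => ¬∃ u ∈ e, h k u < x) ⊆ E := Finset.filter_subset _ _
    obtain ⟨C, J, hC, hJ, hnear, hcost⟩ :=
      ih (E := E.filter fun e => ¬∃ u ∈ e, h k u < x) fun j u v he => hL j u v (hE₁ he)
    refine ⟨(E.filter fun e => (∃ u ∈ e, h k u < x) ∧ ∃ u ∈ e, x ≤ h k u) ∪ C,
      fun z => if h k z < x then k else J z,
      Finset.union_subset (Finset.filter_subset _ _) (hC.trans hE₁), ?_, ?_, ?_⟩
    · intro u v he hn
      rw [Finset.mem_union, not_or, Finset.mem_filter] at hn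
      have hmem : x ≤ h k u → x ≤ h k v → J u = J v := by
        refine fun hu hv => hJ u v (Finset.mem_filter.2 ⟨he, ?_⟩) hn.2
        rintro ⟨y, hy, hlt⟩
        rcases Sym2.mem_iff.1 hy with rfl | rfl <;> linarith
      have hn := hn.1
      simp only [he, true_and, Sym2.mem_iff, exists_eq_or_imp, exists_eq_left] at hn
      grind
    · rintro z ⟨j, hj, hle⟩
      by_cases hz : h k z < x
      · simp only [if_pos hz]
        exact ⟨Nat.lt_succ_self _, hz.trans_le hx.2⟩
      · simp only [if_neg hz]
        have hjk : j ≠ k := by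
          rintro rfl
          exact hz (lt_of_le_of_lt hle hx.1)
        obtain ⟨h₁, h₂⟩ := hnear z ⟨j, by omega, hle⟩
        exact ⟨by omega, h₂⟩
    · have hunion := sum_capacity_union_le c
          (E.filter fun e => (∃ u ∈ e, h k u < x) ∧ ∃ u ∈ e, x ≤ h k u) C
      have hsplit := Finset.sum_filter_add_sum_filter_not E (fun e => ∃ u ∈ e, h k u < x)
        fun e => (c e * l e : ℝ)
      have h₁ : ∑ e ∈ E with (∃ u ∈ e, h k u < x) ∧ ∃ u ∈ e, 1 / 3 < h k u, (c e * l e : ℝ) ≤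
          ∑ e ∈ E with ∃ u ∈ e, h k u < x, (c e * l e : ℝ) :=
        Finset.sum_le_sum_of_subset_of_nonneg
          (Finset.monotone_filter_right _ fun e _ he => he.1) fun e _ _ => hm e
      have h₂ : ∑ e ∈ E with (∃ u ∈ e, h k u < 1 / 2) ∧ ∃ u ∈ e, 1 / 3 < h k u,
          (c e * l e : ℝ) ≤ ∑ e ∈ E, (c e * l e : ℝ) :=
        Finset.sum_le_sum_of_subset_of_nonneg (Finset.filter_subset _ _) fun e _ _ => hm e
      have h₃ : ∑ e ∈ E with ¬∃ u ∈ e, h k u < x, (c e * l e : ℝ) ≤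
          ∑ e ∈ E, (c e * l e : ℝ) :=
        Finset.sum_le_sum_of_subset_of_nonneg hE₁ fun e _ _ => hm e
      have h₄ := mul_le_mul_of_nonneg_left h₁ hκ
      have h₅ := mul_le_mul_of_nonneg_left h₂ (mul_nonneg hκ hη)
      have h₆ := mul_le_mul_of_nonneg_left h₃ (by positivity : 0 ≤ κ * (η * k))
      push_cast
      rw [← hsplit] at h₅ h₆ ⊢
      linarith

variable [Finite V] {bagOf : V → ι} {parent : ι → ι} {root : ι} {r : ℕ}

theorem exists_isTreeWith (htree : ∀ i, ∃ n : ℕ, parent^[n] i = root) :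
    ∃ (par : ι → ι) (dep : ι → ℕ), IsTreeWith par root dep ∧ ∀ i, i ≠ root → par i = parent i := by
  classical
  have hpar : ∀ i, i ≠ root → Function.update parent root root i = parent i :=
    fun i hi => Function.update_of_ne hi _ _
  refine ⟨Function.update parent root root, fun i => Nat.find (htree i),
    ⟨Function.update_self _ _ _, fun i hi => ?_⟩, hpar⟩
  rw [hpar i hi]
  exact Nat.find_comp_succ (htree i) (htree (parent i)) hi

/-- Cutting a small capacity, all vertices of a graph of small width can be assigned to nearby
bags such that uncut edges have both ends assigned to the same bag. -/
theorem exists_bag_assignment (c : Sym2 V → NNReal) (hκ : 0 ≤ κ) (hη : 0 ≤ η)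
    (hexp : 1 + η < η * Real.exp (κ / 6))
    (hsize : ∀ i : ι, Nat.card {v : V // bagOf v = i} ≤ r)
    (htree : ∀ i : ι, ∃ n : ℕ, parent^[n] i = root)
    (hedge : ∀ u v : V, s(u, v) ∈ E →
      bagOf u = bagOf v ∨ bagOf u = parent (bagOf v) ∨ bagOf v = parent (bagOf u)) :
    ∃ (C : Finset (Sym2 V)) (f : V → ι), C ⊆ E ∧
      (∀ u v, s(u, v) ∈ E → s(u, v) ∉ C → f u = f v) ∧ (∀ z, NearBag E l bagOf (f z) z) ∧
      ∑ e ∈ C, (c e : ℝ) ≤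
        κ * ((1 + η) / 2 + (4 + 4 * η * r)) * ∑ e ∈ E, (c e * l e : ℝ) := by
  classical
  have hm : ∀ e : Sym2 V, 0 ≤ (c e * l e : ℝ) := fun e => (c e * l e).2
  obtain ⟨par, dep, hT, hpar⟩ := exists_isTreeWith htree
  let h : V → ℝ := truncDist E l {s | bagOf s = root}
  obtain ⟨x, hx, hcut⟩ := exists_edge_cut_le (h := h) (η := η) (κ := κ / 2) c
    (fun u v he => truncDist_le_add he) (a := 0) (b := 1 / 3) (by norm_num) (by positivity)
    (by convert hexp using 3; ring)
  let E₁ := E.filter fun e => ∀ u ∈ e, x ≤ h u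
  have hE₁ : E₁ ⊆ E := Finset.filter_subset _ _
  have hroot : ∀ z, x ≤ h z → bagOf z ≠ root := by
    intro z hz hbag
    have : h z = 0 := truncDist_eq_zero hbag
    linarith [hx.1]
  have hs : IsState E l bagOf par root r E₁ {z | x ≤ h z} bagOf := by
    refine ⟨hE₁, ⟨fun u v he => ?_, hroot⟩, fun _ _ => rfl, fun i => ?_, fun z => ?_⟩
    · have hfar := (Finset.mem_filter.1 he).2
      have hu := hfar u (Sym2.mem_mk_left _ _)
      have hv := hfar v (Sym2.mem_mk_right _ _)
      rcases hedge u v (hE₁ he) with h | h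
      · exact .inl h
      · rw [hpar _ (hroot u hu), hpar _ (hroot v hv)]
        exact .inr ⟨hu, hv, h⟩
    · refine le_trans ?_ (hsize i)
      exact Set.ncard_le_ncard (t := {v | bagOf v = i}) (fun k hk => hk.2) (Set.toFinite _)
    · exact ⟨0, by norm_num, .base rfl⟩
  obtain ⟨C, f, hC, hf, hnear, hcost⟩ := hs.exists_assignment hT c hκ hη hexp
  refine ⟨(E.filter fun e => (∃ u ∈ e, h u < x) ∧ ∃ u ∈ e, x ≤ h u) ∪ C,
    fun z => if h z < x then root else f z,
    Finset.union_subset (Finset.filter_subset _ _) (hC.trans hE₁), ?_, ?_, ?_⟩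
  · intro u v he hn
    rw [Finset.mem_union, not_or, Finset.mem_filter] at hn
    have hmem : x ≤ h u → x ≤ h v → f u = f v := by
      refine fun hu hv => hf u v (Finset.mem_filter.2 ⟨he, fun y hy => ?_⟩) hn.2
      rcases Sym2.mem_iff.1 hy with rfl | rfl
      exacts [hu, hv]
    have hn := hn.1
    simp only [he, true_and, Sym2.mem_iff, exists_eq_or_imp, exists_eq_left] at hn
    grind
  · intro z
    by_cases hz : h z < x
    · simp only [if_pos hz]
      obtain ⟨d, hd, hnear⟩ := exists_near_lt (hx.2.trans (by norm_num)) hz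
      exact ⟨d, hd.le.trans hx.2, hnear⟩
    · simp only [if_neg hz]
      exact hnear z
  · have hunion := sum_capacity_union_le c
        (E.filter fun e => (∃ u ∈ e, h u < x) ∧ ∃ u ∈ e, x ≤ h u) C
    have h₁ : ∑ e ∈ E with (∃ u ∈ e, h u < x) ∧ ∃ u ∈ e, 0 < h u, (c e * l e : ℝ) ≤
        ∑ e ∈ E, (c e * l e : ℝ) :=
      Finset.sum_le_sum_of_subset_of_nonneg (Finset.filter_subset _ _) fun e _ _ => hm e
    have h₂ : ∑ e ∈ E with (∃ u ∈ e, h u < 1 / 3) ∧ ∃ u ∈ e, 0 < h u, (c e * l e : ℝ) ≤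
        ∑ e ∈ E, (c e * l e : ℝ) :=
      Finset.sum_le_sum_of_subset_of_nonneg (Finset.filter_subset _ _) fun e _ _ => hm e
    have h₃ : ∑ e ∈ E₁, (c e * l e : ℝ) ≤ ∑ e ∈ E, (c e * l e : ℝ) :=
      Finset.sum_le_sum_of_subset_of_nonneg hE₁ fun e _ _ => hm e
    have h₄ := mul_le_mul_of_nonneg_left h₁ hκ
    have h₅ := mul_le_mul_of_nonneg_left h₂ (mul_nonneg hκ hη)
    have h₆ := mul_le_mul_of_nonneg_left h₃ (by positivity : 0 ≤ κ * (4 + 4 * η * r))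
    linarith

/-- The vertices of each bag can be numbered injectively by natural numbers below its size. -/
theorem exists_bag_index (hsize : ∀ i : ι, Nat.card {v : V // bagOf v = i} ≤ r) :
    ∃ idx : V → ℕ, (∀ v, idx v < r) ∧ ∀ u v, bagOf u = bagOf v → idx u = idx v → u = v := by
  classical
  let e : ι → V → ℕ := fun i v =>
    if h : bagOf v = i then Finite.equivFin {v : V // bagOf v = i} ⟨v, h⟩ else 0
  refine ⟨fun v => e (bagOf v) v, fun v => ?_, fun u v huv h => ?_⟩
  · simp only [e, dif_pos]
    exact (Fin.is_lt _).trans_le (hsize _)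
  · simp only [e, huv, dif_pos] at h
    simpa using (Finite.equivFin _).injective (Fin.ext h)

end Assembly

theorem SimpleGraph.Reachable.apply_eq {V α : Type*} {G : SimpleGraph V} {f : V → α}
    (hf : ∀ u v, G.Adj u v → f u = f v) {u v : V} (h : G.Reachable u v) : f u = f v := by
  obtain ⟨p⟩ := h
  induction p with
  | nil => rfl
  | cons h _ ih => exact (hf _ _ h).trans ih

theorem wdist_lt_one {V : Type*} {G : SimpleGraph V} {l : Sym2 V → NNReal} {E : Finset (Sym2 V)}
    (hE : ∀ e ∈ E, e ∈ G.edgeSet) {s u v : V} {d d' : ℝ} (hd : d < 1 / 2) (hd' : d' < 1 / 2)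
    (hu : Near E l {s} u d) (hv : Near E l {s} v d') : wdist G l u v < 1 := by
  obtain ⟨p, hp⟩ := hu.exists_walk hE
  obtain ⟨q, hq⟩ := hv.exists_walk hE
  refine lt_of_le_of_lt (iInf_le _ (p.reverse.append q)) ?_
  have : walkLen l (p.reverse.append q) = walkLen l p + walkLen l q := by
    simp [walkLen]
  rw [this, hp, hq, ← ENNReal.ofReal_add hu.nonneg hv.nonneg, ENNReal.ofReal_lt_one]
  linarith

/-- Main theorem: Every graph `G` of width at most `r` — its vertex set
partitions into bags of size at most `r` arranged on a rooted tree (parent function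
reaching a root) with every edge inside a bag or between a bag and its parent — with
capacities `c` and lengths `l` admits a small diameter decomposition `E'` of total
capacity at most `136·ln(r+1)·Σ_e c(e)·l(e)`: after deleting `E'`, any two vertices in
the same connected component are at `d_G`-distance strictly less than `1`. -/
theorem main_small_diameter_decomposition {V ι : Type*} [Fintype V] [DecidableEq V]
    (G : SimpleGraph V) [DecidableRel G.Adj]
    (c l : Sym2 V → NNReal) (r : ℕ)
    (bagOf : V → ι) (parent : ι → ι) (root : ι)
    (hsize : ∀ i : ι, Nat.card {v : V // bagOf v = i} ≤ r)
    (htree : ∀ i : ι, ∃ n : ℕ, parent^[n] i = root)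
    (hedge : ∀ u v : V, G.Adj u v →
      bagOf u = bagOf v ∨ bagOf u = parent (bagOf v) ∨ bagOf v = parent (bagOf u)) :
    ∃ E' ⊆ G.edgeFinset,
      (∑ e ∈ E', (c e : ℝ)) ≤ 136 * Real.log (r + 1) *
        ∑ e ∈ G.edgeFinset, ((c e : ℝ) * l e) ∧
      ∀ u v : V, (G.deleteEdges ↑E').Reachable u v → wdist G l u v < 1 := by
  classical
  rcases Nat.eq_zero_or_pos r with rfl | hr
  · have hV : IsEmpty V := ⟨fun v => by
      have : Nonempty {w : V // bagOf w = bagOf v} := ⟨⟨v, rfl⟩⟩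
      exact absurd (hsize (bagOf v)) (not_le.2 Nat.card_pos)⟩
    exact ⟨∅, Finset.empty_subset _, by simp, fun u => hV.elim u⟩
  have hr0 : (0 : ℝ) < r := by exact_mod_cast hr
  have hr1 : (1 : ℝ) ≤ r := by exact_mod_cast hr
  set L := Real.log (r + 1) with hLdef
  have hL0 : 0 ≤ L := Real.log_nonneg (by linarith)
  have hη : (0 : ℝ) ≤ 2 / r := by positivity
  have hηr : 2 / (r : ℝ) * r = 2 := by field_simp
  have hη2 : 2 / (r : ℝ) ≤ 2 := div_le_self (by norm_num) hr1
  have hκ : 0 ≤ 6 * L := by positivity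
  have hexp : 1 + 2 / (r : ℝ) < 2 / r * Real.exp (6 * L / 6) := by
    rw [mul_div_cancel_left₀ _ (by norm_num), Real.exp_log (by linarith), mul_add, hηr]
    linarith
  obtain ⟨C₁, f, hC₁, hf, hnear, hcost₁⟩ := exists_bag_assignment (E := G.edgeFinset) (l := l) c
    hκ hη hexp hsize htree fun u v he => hedge u v (SimpleGraph.mem_edgeFinset.1 he)
  obtain ⟨idx, hidx, hinj⟩ := exists_bag_index hsize
  have hsub : (G.edgeFinset.filter fun e => e ∉ C₁) ⊆ G.edgeFinset := Finset.filter_subset _ _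
  obtain ⟨C₂, J, hC₂, hJ, hcenter, hcost₂⟩ := exists_center_assignment
    (E := G.edgeFinset.filter fun e => e ∉ C₁) (l := l) c hκ hη hexp
    (fun j z => truncDist G.edgeFinset l {s | bagOf s = f z ∧ idx s = j} z) r (by
      intro j u v he
      rw [Finset.mem_filter] at he
      simp only [hf u v he.1 he.2]
      exact truncDist_le_add he.1)
  have hnear' : ∀ z, ∃ s, bagOf s = f z ∧ idx s = J z ∧
      ∃ d < (1 / 2 : ℝ), Near G.edgeFinset l {s} z d := by
    intro z
    obtain ⟨d, hd, hz⟩ := hnear z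
    obtain ⟨s, hs, hsz⟩ := hz.exists_mem
    have hle : truncDist G.edgeFinset l {y | bagOf y = f z ∧ idx y = idx s} z ≤ 1 / 3 :=
      (hsz.mono subset_rfl (by rintro _ rfl; exact ⟨hs, rfl⟩)).truncDist_le.trans hd
    obtain ⟨-, hlt⟩ := hcenter z ⟨idx s, hidx s, hle⟩
    obtain ⟨d', hd', hz'⟩ := exists_near_lt (by norm_num) hlt
    obtain ⟨s', hs', hsz'⟩ := hz'.exists_mem
    exact ⟨s', hs'.1, hs'.2, d', hd', hsz'⟩
  refine ⟨C₁ ∪ C₂, Finset.union_subset hC₁ (hC₂.trans hsub), ?_, ?_⟩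
  · have hm : 0 ≤ ∑ e ∈ G.edgeFinset, ((c e : ℝ) * l e) :=
      Finset.sum_nonneg fun e _ => (c e * l e).2
    have hle : ∑ e ∈ G.edgeFinset with e ∉ C₁, ((c e : ℝ) * l e) ≤
        ∑ e ∈ G.edgeFinset, ((c e : ℝ) * l e) :=
      Finset.sum_le_sum_of_subset_of_nonneg hsub fun e _ _ => (c e * l e).2
    have hunion := sum_capacity_union_le c C₁ C₂
    rw [mul_assoc 4, hηr] at hcost₁
    rw [hηr] at hcost₂
    have hLm := mul_nonneg hL0 hm
    have h₁ := mul_le_mul_of_nonneg_right hη2 hLm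
    have h₂ := mul_le_mul_of_nonneg_left hle hL0
    linarith
  · intro u v huv
    have hadj : ∀ a b, (G.deleteEdges ↑(C₁ ∪ C₂)).Adj a b → f a = f b ∧ J a = J b := by
      intro a b hab
      rw [SimpleGraph.deleteEdges_adj, Finset.mem_coe, Finset.mem_union, not_or] at hab
      have he := SimpleGraph.mem_edgeFinset.2 (G.mem_edgeSet.2 hab.1)
      exact ⟨hf a b he hab.2.1, hJ a b (Finset.mem_filter.2 ⟨he, hab.2.1⟩) hab.2.2⟩
    have hfuv := huv.apply_eq fun a b h => (hadj a b h).1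
    have hJuv := huv.apply_eq fun a b h => (hadj a b h).2
    obtain ⟨s, hsf, hsJ, d, hd, hs⟩ := hnear' u
    obtain ⟨s', hsf', hsJ', d', hd', hs'⟩ := hnear' v
    obtain rfl : s = s' := hinj s s' (by rw [hsf, hsf', hfuv]) (by rw [hsJ, hsJ', hJuv])
    exact wdist_lt_one (fun e he => SimpleGraph.mem_edgeFinset.1 he) hd hd' hs hs'
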